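/- arXiv:1409.6069 — 2 statements merged into one kernel-verified Lean document; each statement's English description precedes it below -/
import Mathlib

section
/- Let K be an (m+n)×(m+n) symmetric real matrix admitting a generalized Cholesky factorization K = L·J_{m+n}·Lᵀ with L lower triangular with positive diagonal entries, and let ΔK be an (m+n)×(m+n) symmetric real matrix. If ‖L⁻¹‖₂² · ‖ΔK‖_F < 1/2, then there exists an (m+n)×(m+n) real matrix ΔL such that L + ΔL is lower triangular with positive diagonal entries and K + ΔK = (L + ΔL)·J_{m+n}·(L + ΔL)ᵀ. -/
open Matrix

noncomputable def frobNorm {k : ℕ} (A : Matrix (Fin k) (Fin k) ℝ) : ℝ :=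
  Real.sqrt (∑ i, ∑ j, (A i j) ^ 2)

noncomputable def specNorm {k : ℕ} (A : Matrix (Fin k) (Fin k) ℝ) : ℝ :=
  ‖Matrix.toEuclideanCLM (𝕜 := ℝ) A‖

noncomputable def kappa2 {k : ℕ} (A : Matrix (Fin k) (Fin k) ℝ) : ℝ :=
  specNorm A⁻¹ * specNorm A

noncomputable def upTri {k : ℕ} (A : Matrix (Fin k) (Fin k) ℝ) : Matrix (Fin k) (Fin k) ℝ :=
  Matrix.of fun i j => if i < j then A i j else if i = j then A i i / 2 else 0

noncomputable def Jmat (m n : ℕ) : Matrix (Fin (m + n)) (Fin (m + n)) ℝ :=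
  Matrix.diagonal fun i => if (i : ℕ) < m then 1 else -1

def IsLowerTri {k : ℕ} (A : Matrix (Fin k) (Fin k) ℝ) : Prop :=
  ∀ i j, i < j → A i j = 0

def IsUpperTri {k : ℕ} (A : Matrix (Fin k) (Fin k) ℝ) : Prop :=
  ∀ i j, j < i → A i j = 0

def PosDiag {k : ℕ} (A : Matrix (Fin k) (Fin k) ℝ) : Prop :=
  ∀ i, 0 < A i i

noncomputable def entAbs {k : ℕ} (A : Matrix (Fin k) (Fin k) ℝ) : Matrix (Fin k) (Fin k) ℝ :=
  Matrix.of fun i j => |A i j|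

noncomputable def condF {k : ℕ} (A : Matrix (Fin k) (Fin k) ℝ) : ℝ :=
  frobNorm (entAbs A⁻¹ * entAbs A)

/-- Assembling a factorization of a symmetric `2 × 2` block matrix from a Cholesky factor of its
leading block and a factor of the corresponding Schur complement. -/
lemma exists_lowerTri_of_blocks {p q : ℕ} (s : ℝ) (A : Matrix (Fin (p + q)) (Fin (p + q)) ℝ)
    (H : Matrix (Fin p) (Fin p) ℝ) (B : Matrix (Fin p) (Fin q) ℝ) (C : Matrix (Fin q) (Fin q) ℝ)
    (hA : A.submatrix finSumFinEquiv finSumFinEquiv = fromBlocks H B Bᵀ C)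
    (M₁ : Matrix (Fin p) (Fin p) ℝ) (h₁ : IsLowerTri M₁) (d₁ : PosDiag M₁) (hM₁ : H = M₁ * M₁ᵀ)
    (hu : IsUnit M₁.det) (M₂ : Matrix (Fin q) (Fin q) ℝ) (h₂ : IsLowerTri M₂) (d₂ : PosDiag M₂)
    (hM₂ : C - Bᵀ * H⁻¹ * B = s • (M₂ * M₂ᵀ)) :
    ∃ M : Matrix (Fin (p + q)) (Fin (p + q)) ℝ, IsLowerTri M ∧ PosDiag M ∧
      A = M * diagonal (fun i : Fin (p + q) => if (i : ℕ) < p then 1 else s) * Mᵀ := by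
  set N : Matrix (Fin p ⊕ Fin q) (Fin p ⊕ Fin q) ℝ :=
    fromBlocks M₁ 0 (Bᵀ * M₁ᵀ⁻¹) M₂ with hN
  have hut : IsUnit M₁ᵀ.det := by rwa [det_transpose]
  have hD : (diagonal (fun i : Fin (p + q) => if (i : ℕ) < p then (1 : ℝ) else s)).submatrix
      finSumFinEquiv finSumFinEquiv = fromBlocks 1 0 0 (s • 1) := by
    rw [submatrix_diagonal_equiv, ← diagonal_one, ← diagonal_one, ← diagonal_smul,
      fromBlocks_diagonal]
    congr 1
    ext i
    rcases i with i | i <;> simp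
  have hf : A.submatrix finSumFinEquiv finSumFinEquiv =
      N * fromBlocks 1 0 0 (s • 1) * Nᵀ := by
    have hC : C = Bᵀ * M₁ᵀ⁻¹ * (M₁⁻¹ * B) + s • (M₂ * M₂ᵀ) := by
      rw [← hM₂, hM₁, Matrix.mul_inv_rev]
      simp only [Matrix.mul_assoc]
      abel
    have hB : M₁ * (M₁⁻¹ * B) = B := by
      rw [← Matrix.mul_assoc, mul_nonsing_inv _ hu, Matrix.one_mul]
    have hBt : Bᵀ * M₁ᵀ⁻¹ * M₁ᵀ = Bᵀ := by
      rw [Matrix.mul_assoc, nonsing_inv_mul _ hut, Matrix.mul_one]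
    rw [hA, hN, fromBlocks_transpose, fromBlocks_multiply, fromBlocks_multiply]
    simp only [transpose_mul, transpose_nonsing_inv, transpose_transpose, Matrix.mul_one,
      Matrix.mul_zero, add_zero, zero_add, Matrix.zero_mul, transpose_zero, Matrix.mul_smul,
      Matrix.smul_mul, smul_zero, hB, hBt, ← hC, ← hM₁]
  refine ⟨N.submatrix finSumFinEquiv.symm finSumFinEquiv.symm, ?_, ?_, ?_⟩
  · intro i j hij
    obtain ⟨i, rfl⟩ := finSumFinEquiv.surjective i
    obtain ⟨j, rfl⟩ := finSumFinEquiv.surjective j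
    rcases i with i | i <;> rcases j with j | j <;>
      simp only [finSumFinEquiv_apply_left, finSumFinEquiv_apply_right, Fin.lt_def,
        Fin.val_castAdd, Fin.val_natAdd] at hij
    · simpa [hN] using h₁ i j hij
    · simp [hN]
    · omega
    · simpa [hN] using h₂ i j (by simpa using hij)
  · intro i
    obtain ⟨i, rfl⟩ := finSumFinEquiv.surjective i
    rcases i with i | i
    · simpa [hN] using d₁ i
    · simpa [hN] using d₂ i
  · apply (reindex finSumFinEquiv.symm finSumFinEquiv.symm).injective
    simp only [reindex_apply, Equiv.symm_symm]
    rw [hf, ← hD, ← submatrix_mul_equiv _ _ _ finSumFinEquiv,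
      ← submatrix_mul_equiv _ _ _ finSumFinEquiv]
    simp

lemma isUnit_det_of_isLowerTri {k : ℕ} {M : Matrix (Fin k) (Fin k) ℝ} (h : IsLowerTri M)
    (d : PosDiag M) : IsUnit M.det := by
  have hdet : M.det = ∏ i, M i i := det_of_isLowerTriangular M fun i j hij => h i j hij
  rw [hdet]
  exact (Finset.prod_pos fun i _ => d i).ne'.isUnit

lemma eq_fromBlocks_of_transpose_eq {p q : ℕ} {A : Matrix (Fin p ⊕ Fin q) (Fin p ⊕ Fin q) ℝ}
    (h : Aᵀ = A) : A = fromBlocks A.toBlocks₁₁ A.toBlocks₁₂ A.toBlocks₁₂ᵀ A.toBlocks₂₂ := by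
  have : A.toBlocks₁₂ᵀ = A.toBlocks₂₁ := by
    ext i j
    exact congrFun (congrFun h (Sum.inr i)) (Sum.inl j)
  rw [this, fromBlocks_toBlocks]

theorem Matrix.PosDef.exists_cholesky {k : ℕ} {A : Matrix (Fin k) (Fin k) ℝ} (hA : A.PosDef) :
    ∃ M : Matrix (Fin k) (Fin k) ℝ, IsLowerTri M ∧ PosDiag M ∧ A = M * Mᵀ := by
  induction k with
  | zero => exact ⟨0, fun i => i.elim0, fun i => i.elim0, Subsingleton.elim _ _⟩
  | succ k ih =>
    set A' := A.submatrix (finSumFinEquiv (m := k) (n := 1)) finSumFinEquiv with hA'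
    have hpd : A'.PosDef := hA.submatrix finSumFinEquiv.injective
    have hb : A' = _ := eq_fromBlocks_of_transpose_eq (by simpa using hpd.isHermitian.eq)
    have hH : A'.toBlocks₁₁.PosDef := hpd.submatrix Sum.inl_injective
    obtain ⟨M₁, h₁, d₁, hM₁⟩ := ih hH
    have := hH.isUnit.invertible
    have hdet := hpd.det_pos
    rw [hb, det_fromBlocks₁₁, invOf_eq_nonsing_inv] at hdet
    have hS := pos_of_mul_pos_right hdet hH.det_pos.le
    rw [det_fin_one] at hS
    set S := A'.toBlocks₂₂ - A'.toBlocks₁₂ᵀ * A'.toBlocks₁₁⁻¹ * A'.toBlocks₁₂ with hSd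
    obtain ⟨M, hM, dM, hf⟩ := exists_lowerTri_of_blocks 1 A _ _ _ hb M₁ h₁ d₁ hM₁
      (isUnit_det_of_isLowerTri h₁ d₁) (of fun _ _ => √(S 0 0))
      (fun i j hij => absurd hij (by simp [Subsingleton.elim i j]))
      (fun i => by simpa using hS) (by
        rw [← hSd]
        ext i j
        simp [Subsingleton.elim i 0, Subsingleton.elim j 0, mul_apply, Real.mul_self_sqrt hS.le])
    refine ⟨M, hM, dM, ?_⟩
    simpa using hf

/-- A symmetric quasi-definite matrix has a generalized Cholesky factorization. -/
theorem exists_generalized_cholesky {m n : ℕ} {A : Matrix (Fin (m + n)) (Fin (m + n)) ℝ}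
    (hA : Aᵀ = A) (hp : (A.submatrix (Fin.castAdd n) (Fin.castAdd n)).PosDef)
    (hn : (-A.submatrix (Fin.natAdd m) (Fin.natAdd m)).PosDef) :
    ∃ M : Matrix (Fin (m + n)) (Fin (m + n)) ℝ, IsLowerTri M ∧ PosDiag M ∧
      A = M * Jmat m n * Mᵀ := by
  set A' := A.submatrix (finSumFinEquiv (m := m) (n := n)) finSumFinEquiv with hA'
  have hb : A' = _ := eq_fromBlocks_of_transpose_eq (by rw [hA', transpose_submatrix, hA])
  have hp' : A'.toBlocks₁₁.PosDef := hp
  have hn' : (-A'.toBlocks₂₂).PosDef := hn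
  obtain ⟨M₁, h₁, d₁, hM₁⟩ := hp'.exists_cholesky
  have hS : (-A'.toBlocks₂₂ + A'.toBlocks₁₂ᵀ * A'.toBlocks₁₁⁻¹ * A'.toBlocks₁₂).PosDef := by
    refine hn'.add_posSemidef ?_
    simpa using hp'.inv.posSemidef.conjTranspose_mul_mul_same A'.toBlocks₁₂
  obtain ⟨M₂, h₂, d₂, hM₂⟩ := hS.exists_cholesky
  exact exists_lowerTri_of_blocks (-1) A _ _ _ hb M₁ h₁ d₁ hM₁
    (isUnit_det_of_isLowerTri h₁ d₁) M₂ h₂ d₂ (by rw [← hM₂, neg_one_smul]; abel)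

lemma abs_dotProduct_mulVec_le_frobNorm {k : ℕ} (A : Matrix (Fin k) (Fin k) ℝ) (y : Fin k → ℝ) :
    |y ⬝ᵥ A *ᵥ y| ≤ frobNorm A * (y ⬝ᵥ y) := by
  have hy : 0 ≤ y ⬝ᵥ y := by simpa using dotProduct_star_self_nonneg y
  refine abs_le_of_sq_le_sq ?_ (mul_nonneg (Real.sqrt_nonneg _) hy)
  have h := Finset.sum_mul_sq_le_sq_mul_sq Finset.univ (fun p : Fin k × Fin k => A p.1 p.2)
    (fun p => y p.1 * y p.2)
  have h₁ : ∑ p : Fin k × Fin k, A p.1 p.2 * (y p.1 * y p.2) = y ⬝ᵥ A *ᵥ y := by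
    simp only [Fintype.sum_prod_type, dotProduct, mulVec, Finset.mul_sum]
    exact Finset.sum_congr rfl fun i _ => Finset.sum_congr rfl fun j _ => by ring
  have h₂ : ∑ p : Fin k × Fin k, (y p.1 * y p.2) ^ 2 = (y ⬝ᵥ y) ^ 2 := by
    simp only [Fintype.sum_prod_type, dotProduct, sq, Finset.sum_mul_sum]
    exact Finset.sum_congr rfl fun i _ => Finset.sum_congr rfl fun j _ => by ring
  have h₃ : ∑ p : Fin k × Fin k, A p.1 p.2 ^ 2 = frobNorm A ^ 2 := by
    rw [frobNorm, Real.sq_sqrt (by positivity), Fintype.sum_prod_type]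
  rwa [h₁, h₂, h₃, ← mul_pow] at h

lemma specNorm_transpose {k : ℕ} (A : Matrix (Fin k) (Fin k) ℝ) : specNorm Aᵀ = specNorm A := by
  rw [← conjTranspose_eq_transpose_of_trivial]
  exact l2_opNorm_conjTranspose A

lemma dotProduct_mulVec_self_le {k : ℕ} (A : Matrix (Fin k) (Fin k) ℝ) (x : Fin k → ℝ) :
    (A *ᵥ x) ⬝ᵥ (A *ᵥ x) ≤ specNorm A ^ 2 * (x ⬝ᵥ x) := by
  have h := (toEuclideanCLM (𝕜 := ℝ) A).le_opNorm (WithLp.toLp 2 x)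
  have h' := pow_le_pow_left₀ (norm_nonneg _) h 2
  rw [mul_pow, EuclideanSpace.real_norm_sq_eq, EuclideanSpace.real_norm_sq_eq] at h'
  simpa [dotProduct, ← sq, specNorm] using h'

/-- The quadratic form of a congruence transform is controlled by the norms of its factors. -/
lemma abs_dotProduct_congr_mulVec_le {k : ℕ} (P D : Matrix (Fin k) (Fin k) ℝ) (x : Fin k → ℝ) :
    |x ⬝ᵥ (P * D * Pᵀ) *ᵥ x| ≤ specNorm P ^ 2 * frobNorm D * (x ⬝ᵥ x) := by
  have h : x ⬝ᵥ (P * D * Pᵀ) *ᵥ x = (Pᵀ *ᵥ x) ⬝ᵥ D *ᵥ (Pᵀ *ᵥ x) := by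
    rw [← mulVec_mulVec, ← mulVec_mulVec, dotProduct_mulVec, mulVec_transpose]
  rw [h]
  refine (abs_dotProduct_mulVec_le_frobNorm _ _).trans ?_
  have hD : 0 ≤ frobNorm D := Real.sqrt_nonneg _
  have h' := mul_le_mul_of_nonneg_left (dotProduct_mulVec_self_le Pᵀ x) hD
  rw [specNorm_transpose] at h'
  linarith

/-- A principal submatrix of `diagonal d + E`, on indices where `d` is `1`, is positive definite
when the quadratic form of `E` is smaller than the squared Euclidean norm. -/
lemma posDef_submatrix_diagonal_add {ι κ : Type*} [Fintype ι] [DecidableEq ι]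
    (d : ι → ℝ) (E : Matrix ι ι ℝ) (hE : Eᵀ = E)
    (hlt : ∀ x : ι → ℝ, x ≠ 0 → |x ⬝ᵥ E *ᵥ x| < x ⬝ᵥ x) (f : κ → ι) (hf : f.Injective)
    (hd : ∀ a, d (f a) = 1) : ((diagonal d + E).submatrix f f).PosDef := by
  have hpd : (1 + E).PosDef := by
    refine PosDef.of_dotProduct_mulVec_pos (isHermitian_one.add ?_) fun x hx => ?_
    · rw [IsHermitian, conjTranspose_eq_transpose_of_trivial, hE]
    · have := (abs_lt.mp (hlt x hx)).1
      rw [star_trivial, add_mulVec, one_mulVec, dotProduct_add]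
      linarith
  have hsub : (diagonal d + E).submatrix f f = (1 + E).submatrix f f := by
    ext a b
    by_cases hab : f a = f b
    · simp [← hab, hd]
    · simp [hab]
  rw [hsub]
  exact hpd.submatrix hf

lemma IsLowerTri.mul {k : ℕ} {A B : Matrix (Fin k) (Fin k) ℝ} (hA : IsLowerTri A)
    (hB : IsLowerTri B) : IsLowerTri (A * B) := by
  intro i j hij
  rw [mul_apply]
  refine Finset.sum_eq_zero fun l _ => ?_
  rcases lt_or_ge i l with h | h
  · rw [hA i l h, zero_mul]
  · rw [hB l j (h.trans_lt hij), mul_zero]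

lemma PosDiag.mul {k : ℕ} {A B : Matrix (Fin k) (Fin k) ℝ} (hA : PosDiag A) (hB : PosDiag B)
    (tA : IsLowerTri A) (tB : IsLowerTri B) : PosDiag (A * B) := by
  intro i
  rw [mul_apply, Finset.sum_eq_single i]
  · exact mul_pos (hA i) (hB i)
  · intro l _ hl
    rcases hl.lt_or_gt with h | h
    · rw [tB l i h, mul_zero]
    · rw [tA i l h, zero_mul]
  · simp

theorem stmt7 (m n : ℕ) (K L dK : Matrix (Fin (m + n)) (Fin (m + n)) ℝ)
    (hK : Kᵀ = K) (hL : IsLowerTri L) (hLd : PosDiag L)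
    (hfact : K = L * Jmat m n * Lᵀ)
    (hdK : dKᵀ = dK)
    (hsmall : specNorm L⁻¹ ^ 2 * frobNorm dK < 1 / 2) :
    ∃ dL : Matrix (Fin (m + n)) (Fin (m + n)) ℝ,
      IsLowerTri (L + dL) ∧ PosDiag (L + dL) ∧
      K + dK = (L + dL) * Jmat m n * (L + dL)ᵀ := by
  have hu := isUnit_det_of_isLowerTri hL hLd
  set E := L⁻¹ * dK * L⁻¹ᵀ with hEd
  have hE : Eᵀ = E := by
    simp only [hEd, transpose_mul, transpose_transpose, hdK, Matrix.mul_assoc]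
  have hlt (x : Fin (m + n) → ℝ) (hx : x ≠ 0) : |x ⬝ᵥ E *ᵥ x| < x ⬝ᵥ x := by
    have hpos : 0 < x ⬝ᵥ x := by simpa using dotProduct_star_self_pos_iff.mpr hx
    refine (abs_dotProduct_congr_mulVec_le L⁻¹ dK x).trans_lt ?_
    nlinarith
  obtain ⟨M, hM, dM, hf⟩ := exists_generalized_cholesky (m := m) (n := n) (A := Jmat m n + E)
    (by rw [transpose_add, hE, Jmat, diagonal_transpose])
    (posDef_submatrix_diagonal_add _ E hE hlt _ (Fin.castAdd_injective m n) (by simp))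
    (by
      have h := posDef_submatrix_diagonal_add
        (-fun i : Fin (m + n) => if (i : ℕ) < m then (1 : ℝ) else -1) (-E)
        (by rw [transpose_neg, hE]) (by simpa [neg_mulVec] using hlt) _
        (Fin.natAdd_injective n m) (by simp)
      have hneg : diagonal (-fun i : Fin (m + n) => if (i : ℕ) < m then (1 : ℝ) else -1) =
          -Jmat m n := (diagonal_neg _).symm
      rw [hneg, ← neg_add] at h
      exact h)
  have hK' : K + dK = (L * M) * Jmat m n * (L * M)ᵀ := by
    have h₁ : L * L⁻¹ = 1 := mul_nonsing_inv _ hu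
    have h₂ : L⁻¹ᵀ * Lᵀ = 1 := by rw [← transpose_mul, h₁, transpose_one]
    calc K + dK = L * Jmat m n * Lᵀ + (L * L⁻¹) * dK * (L⁻¹ᵀ * Lᵀ) := by
          rw [h₁, h₂, Matrix.one_mul, Matrix.mul_one, hfact]
      _ = L * (Jmat m n + E) * Lᵀ := by
          simp only [hEd, Matrix.mul_add, Matrix.add_mul, Matrix.mul_assoc]
      _ = _ := by
          rw [hf, transpose_mul]
          simp only [Matrix.mul_assoc]
  refine ⟨L * M - L, ?_, ?_, ?_⟩
  · rw [add_sub_cancel]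
    exact hL.mul hM
  · rw [add_sub_cancel]
    exact hLd.mul dM hL hM
  · rw [add_sub_cancel]
    exact hK'
end

section
/- Let K be an (m+n)×(m+n) symmetric real matrix with generalized Cholesky factorization K = L·J_{m+n}·Lᵀ, where L is lower triangular with positive diagonal entries, and let ΔK be an (m+n)×(m+n) symmetric real matrix with ‖L⁻¹‖₂² · ‖ΔK‖_F < 1/2. If ΔL is a matrix such that L + ΔL is lower triangular with positive diagonal entries and K + ΔK = (L + ΔL)·J_{m+n}·(L + ΔL)ᵀ, then for every (m+n)×(m+n) diagonal matrix D with positive diagonal entries, ‖(ΔL)ᵀ·L⁻ᵀ·D‖_F ≤ √2 · ‖L⁻¹‖₂ · ‖L⁻ᵀ·D‖₂ · ‖ΔK‖_F / (√2 − 1 + √(1 − 2·‖L⁻¹‖₂²·‖ΔK‖_F)). -/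
open Matrix

section FrobeniusNorm

attribute [local instance] Matrix.frobeniusNormedAddCommGroup

lemma frobenius_norm_eq_sqrt {α β : Type*} [Fintype α] [Fintype β] (A : Matrix α β ℝ) :
    ‖A‖ = Real.sqrt (∑ i, ∑ j, (A i j) ^ 2) := by
  rw [Matrix.frobenius_norm_def, Real.sqrt_eq_rpow]
  simp

lemma frobNorm_sub_le {k : ℕ} (A B : Matrix (Fin k) (Fin k) ℝ) :
    frobNorm (A - B) ≤ frobNorm A + frobNorm B := by
  simp only [frobNorm, ← frobenius_norm_eq_sqrt]
  exact norm_sub_le A B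

lemma frobNorm_mul_le {k : ℕ} (A B : Matrix (Fin k) (Fin k) ℝ) :
    frobNorm (A * B) ≤ frobNorm A * frobNorm B := by
  simp only [frobNorm, ← frobenius_norm_eq_sqrt]
  exact Matrix.frobenius_norm_mul A B

/-- If `w + X w = e` then `‖w‖ (1 - ‖X‖_F) ≤ ‖e‖`. -/
lemma sqrt_sum_sq_mul_one_sub_frobNorm_le {k : ℕ} (X : Matrix (Fin k) (Fin k) ℝ)
    (w e : Fin k → ℝ) (h : ∀ i, e i = w i + ∑ l, X i l * w l) :
    Real.sqrt (∑ i, w i ^ 2) * (1 - frobNorm X) ≤ Real.sqrt (∑ i, e i ^ 2) := by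
  let W : Matrix (Fin k) (Fin 1) ℝ := Matrix.of fun i _ => w i
  let V : Matrix (Fin k) (Fin 1) ℝ := Matrix.of fun i _ => e i
  have hW : ‖W‖ = Real.sqrt (∑ i, w i ^ 2) := by simp [frobenius_norm_eq_sqrt, W]
  have hV : ‖V‖ = Real.sqrt (∑ i, e i ^ 2) := by simp [frobenius_norm_eq_sqrt, V]
  have hX : ‖X‖ = frobNorm X := frobenius_norm_eq_sqrt X
  have hWV : W = V - X * W := by
    ext i j
    simp [W, V, Matrix.mul_apply, h]
  have h1 : ‖W‖ ≤ ‖V‖ + ‖X * W‖ := by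
    conv_lhs => rw [hWV]
    exact norm_sub_le _ _
  have h2 := Matrix.frobenius_norm_mul X W
  rw [← hW, ← hV, ← hX]
  linarith

end FrobeniusNorm

lemma frobNorm_nonneg {k : ℕ} (A : Matrix (Fin k) (Fin k) ℝ) : 0 ≤ frobNorm A :=
  Real.sqrt_nonneg _

lemma frobNorm_sq {k : ℕ} (A : Matrix (Fin k) (Fin k) ℝ) :
    frobNorm A ^ 2 = ∑ i, ∑ j, (A i j) ^ 2 :=
  Real.sq_sqrt (Finset.sum_nonneg fun _ _ => Finset.sum_nonneg fun _ _ => sq_nonneg _)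

lemma frobNorm_transpose {k : ℕ} (A : Matrix (Fin k) (Fin k) ℝ) :
    frobNorm Aᵀ = frobNorm A := by
  rw [frobNorm, Finset.sum_comm]
  rfl

lemma frobNorm_diagonal_mul {k : ℕ} {σ : Fin k → ℝ} (hσ : ∀ i, σ i ^ 2 = 1)
    (A : Matrix (Fin k) (Fin k) ℝ) : frobNorm (diagonal σ * A) = frobNorm A := by
  simp [frobNorm, Matrix.diagonal_mul, mul_pow, hσ]

lemma specNorm_nonneg {k : ℕ} (A : Matrix (Fin k) (Fin k) ℝ) : 0 ≤ specNorm A :=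
  norm_nonneg _

lemma frobNorm_mul_le_specNorm_mul {k : ℕ} (A B : Matrix (Fin k) (Fin k) ℝ) :
    frobNorm (A * B) ≤ specNorm A * frobNorm B := by
  refine le_of_sq_le_sq ?_ (mul_nonneg (specNorm_nonneg A) (frobNorm_nonneg B))
  rw [mul_pow, frobNorm_sq, frobNorm_sq, Finset.sum_comm, Finset.sum_comm (f := fun i j => B i j ^ 2),
    Finset.mul_sum]
  refine Finset.sum_le_sum fun j _ => ?_
  have h := (Matrix.toEuclideanCLM (𝕜 := ℝ) A).le_opNorm (WithLp.toLp 2 fun i => B i j)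
  have h2 := pow_le_pow_left₀ (norm_nonneg _) h 2
  rw [mul_pow, EuclideanSpace.real_norm_sq_eq, EuclideanSpace.real_norm_sq_eq] at h2
  simpa [specNorm, Matrix.mul_apply, Matrix.mulVec, dotProduct] using h2

lemma frobNorm_mul_le_mul_specNorm {k : ℕ} (A B : Matrix (Fin k) (Fin k) ℝ) :
    frobNorm (A * B) ≤ frobNorm A * specNorm B := by
  rw [← frobNorm_transpose, Matrix.transpose_mul, ← frobNorm_transpose A, ← specNorm_transpose B,
    mul_comm]
  exact frobNorm_mul_le_specNorm_mul _ _

section LowerTriangular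

variable {k : ℕ} {σ : Fin k → ℝ} {X : Matrix (Fin k) (Fin k) ℝ}

lemma sq_apply_transpose_le_of_isLowerTri (hσ : ∀ i, σ i ^ 2 = 1) (hX : IsLowerTri X)
    (i j : Fin k) :
    Xᵀ i j ^ 2 ≤ (X * diagonal σ + diagonal σ * Xᵀ) i j ^ 2 := by
  simp only [Matrix.add_apply, Matrix.mul_diagonal, Matrix.diagonal_mul, Matrix.transpose_apply]
  rcases lt_trichotomy i j with h | h | h
  · rw [hX i j h]
    simp [mul_pow, hσ]
  · subst h
    have h1 : (X i i * σ i + σ i * X i i) ^ 2 = 4 * (σ i ^ 2 * X i i ^ 2) := by ring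
    rw [h1, hσ]
    nlinarith [sq_nonneg (X i i)]
  · rw [hX j i h]
    simp [sq_nonneg]

lemma sqrt_two_mul_frobNorm_le_of_isLowerTri (hσ : ∀ i, σ i ^ 2 = 1) (hX : IsLowerTri X) :
    Real.sqrt 2 * frobNorm X ≤ frobNorm (X * diagonal σ + diagonal σ * Xᵀ) := by
  refine le_of_sq_le_sq ?_ (frobNorm_nonneg _)
  have h : ∀ i j, X i j ^ 2 + X j i ^ 2 ≤ (X * diagonal σ + diagonal σ * Xᵀ) i j ^ 2 := by
    intro i j
    simp only [Matrix.add_apply, Matrix.mul_diagonal, Matrix.diagonal_mul, Matrix.transpose_apply]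
    rcases lt_trichotomy i j with h | h | h
    · rw [hX i j h]
      simp [mul_pow, hσ]
    · subst h
      have h1 : (X i i * σ i + σ i * X i i) ^ 2 = 4 * (σ i ^ 2 * X i i ^ 2) := by ring
      rw [h1, hσ]
      nlinarith [sq_nonneg (X i i)]
    · rw [hX j i h]
      simp [mul_pow, hσ]
  rw [mul_pow, Real.sq_sqrt zero_le_two]
  calc 2 * frobNorm X ^ 2 = frobNorm X ^ 2 + frobNorm Xᵀ ^ 2 := by
        rw [frobNorm_transpose]; ring
    _ = ∑ i, ∑ j, (X i j ^ 2 + X j i ^ 2) := by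
        simp only [frobNorm_sq, Finset.sum_add_distrib, Matrix.transpose_apply]
    _ ≤ _ := by
        rw [frobNorm_sq]
        exact Finset.sum_le_sum fun i _ => Finset.sum_le_sum fun j _ => h i j

lemma add_mul_diagonal_mul_transpose_apply (X : Matrix (Fin k) (Fin k) ℝ) (σ : Fin k → ℝ)
    (i j : Fin k) :
    (X * diagonal σ + diagonal σ * Xᵀ + X * diagonal σ * Xᵀ) i j =
      X i j * σ j + σ i * X j i + ∑ l, X i l * σ l * X j l := by
  rw [Matrix.add_apply, Matrix.add_apply, Matrix.mul_diagonal, Matrix.diagonal_mul,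
    Matrix.mul_apply]
  simp only [Matrix.mul_diagonal, Matrix.transpose_apply]

/-- The quadratic inequality satisfied by the relative perturbation of the triangular factor. -/
lemma sqrt_two_mul_frobNorm_le_add_sq {E : Matrix (Fin k) (Fin k) ℝ}
    (hσ : ∀ i, σ i ^ 2 = 1) (hX : IsLowerTri X)
    (h : X * diagonal σ + diagonal σ * Xᵀ + X * diagonal σ * Xᵀ = E) :
    Real.sqrt 2 * frobNorm X ≤ frobNorm E + frobNorm X ^ 2 := by
  have h1 : X * diagonal σ + diagonal σ * Xᵀ = E - X * (diagonal σ * Xᵀ) := by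
    rw [← h, Matrix.mul_assoc]; abel
  have h2 := sqrt_two_mul_frobNorm_le_of_isLowerTri hσ hX
  rw [h1] at h2
  have h3 := frobNorm_sub_le E (X * (diagonal σ * Xᵀ))
  have h4 := frobNorm_mul_le X (diagonal σ * Xᵀ)
  rw [frobNorm_diagonal_mul hσ, frobNorm_transpose] at h4
  nlinarith

end LowerTriangular

lemma quartic_le_half_sq {s : ℝ} (hs0 : 0 ≤ s) (hs1 : s ≤ 1) :
    (1 - s) ^ 2 * (1 + 2 * s - s ^ 2) / 4 ≤ (1 - 3 / 4 * s) ^ 2 / 2 := by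
  have h1 : (1 - s) ^ 2 ≤ (1 - 3 / 4 * s) ^ 2 :=
    pow_le_pow_left₀ (by linarith) (by linarith) 2
  nlinarith [mul_nonneg (sq_nonneg (1 - s)) (sq_nonneg (1 - s))]

lemma two_mul_quartic_le {s : ℝ} (hs1 : s ≤ 1) :
    2 * ((1 - s) ^ 2 * (1 + 2 * s - s ^ 2) / 4) ≤ (1 - s ^ 2) / 2 := by
  have h1 : (1 - s) * (1 + 2 * s - s ^ 2) ≤ 1 + s := by
    linarith [mul_nonneg (sq_nonneg s) (sub_nonneg.2 hs1), sq_nonneg s]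
  linarith [mul_le_mul_of_nonneg_left h1 (sub_nonneg.2 hs1)]

lemma three_quarters_mul_quartic_le {s : ℝ} (hs0 : 0 ≤ s) (hs1 : s ≤ 1) :
    3 / 4 * ((1 - s) ^ 2 * (1 + 2 * s - s ^ 2) / 4) ≤
      (1 - 3 / 4 * s) ^ 2 * ((1 - s ^ 2) / 2) := by
  have h1 : (1 - s) * (1 + 2 * s - s ^ 2) ≤ 8 / 3 * (1 + s) * (1 - 3 / 4 * s) ^ 2 := by
    linarith [sq_nonneg (1 - s), mul_nonneg hs0 (sq_nonneg (1 - s))]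
  linarith [mul_le_mul_of_nonneg_left h1 (sub_nonneg.2 hs1)]

lemma add_sq_le_of_weighted_le {b c q η W ξ : ℝ} (hb : 0 < b) (hW : 0 ≤ W)
    (hlin : 2 * (W * b) + η ^ 2 ≤ q) (hqb : q ≤ b / 2) (hq1 : 2 * q ≤ c) (hq2 : 3 / 4 * q ≤ b * c)
    (hξ : |ξ| ≤ |η| + W) : W + ξ ^ 2 ≤ c := by
  have hW4 : W ≤ 1 / 4 := by
    have : W * b ≤ 1 / 4 * b := by linarith [sq_nonneg η]
    exact le_of_mul_le_mul_right this hb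
  have hξ2 : ξ ^ 2 ≤ 2 * η ^ 2 + 2 * W ^ 2 := by
    have h1 := pow_le_pow_left₀ (abs_nonneg ξ) hξ 2
    rw [sq_abs] at h1
    linarith [sq_nonneg (|η| - W), sq_abs η]
  have hmain : 3 / 2 * W + 2 * η ^ 2 ≤ c := by
    rcases le_total (3 / 8) b with hc | hc
    · linarith [mul_le_mul_of_nonneg_left hc hW]
    · have h1 : b * (3 / 2 * W + 2 * η ^ 2) ≤ b * c := by
        linarith [mul_le_mul_of_nonneg_right hc (sq_nonneg η)]
      exact le_of_mul_le_mul_left h1 hb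
  linarith [mul_nonneg hW (sub_nonneg.2 hW4)]

lemma sq_add_add_sq_le_half {x ε a η W ξ : ℝ} (hx : 0 ≤ x) (hx2 : x ^ 2 ≤ 1 / 2)
    (hε : Real.sqrt 2 * x ≤ ε + x ^ 2) (hsum : ε ^ 2 + 2 * a + η ^ 2 ≤ 1 / 4)
    (hW : 0 ≤ W) (hWa : W * (1 - x) ^ 2 ≤ a) (hξ : |ξ| ≤ |η| + W) :
    x ^ 2 + W + ξ ^ 2 ≤ 1 / 2 := by
  obtain ⟨s, hs⟩ : ∃ s, s = Real.sqrt 2 * x := ⟨_, rfl⟩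
  have h2 : Real.sqrt 2 ^ 2 = 2 := Real.sq_sqrt zero_le_two
  have hr : 4 / 3 ≤ Real.sqrt 2 := Real.le_sqrt_of_sq_le (by norm_num)
  have hs0 : 0 ≤ s := by rw [hs]; positivity
  have hs2 : s ^ 2 = 2 * x ^ 2 := by rw [hs, mul_pow, h2]
  have hs1 : s ≤ 1 := le_of_sq_le_sq (by linarith) zero_le_one
  have hxs : x ≤ 3 / 4 * s := by
    rw [hs]; linarith [mul_le_mul_of_nonneg_right hr hx]
  have hb : (1 - 3 / 4 * s) ^ 2 ≤ (1 - x) ^ 2 :=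
    pow_le_pow_left₀ (by linarith) (by linarith) 2
  have hWb : W * (1 - 3 / 4 * s) ^ 2 ≤ a := (mul_le_mul_of_nonneg_left hb hW).trans hWa
  have hεs : (s - s ^ 2 / 2) ^ 2 ≤ ε ^ 2 :=
    pow_le_pow_left₀ (by linarith [mul_nonneg hs0 (sub_nonneg.2 hs1)]) (by linarith) 2
  have := add_sq_le_of_weighted_le (η := η) (pow_pos (by linarith) 2) hW (by linarith)
    (quartic_le_half_sq hs0 hs1) (two_mul_quartic_le hs1)
    (three_quarters_mul_quartic_le hs0 hs1) hξ
  linarith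

/-- The relative perturbation of the triangular factor lies on the small branch of the quadratic
inequality `sqrt_two_mul_frobNorm_le_add_sq`. -/
lemma frobNorm_sq_le_half_of_isLowerTri {k : ℕ} {σ : Fin k → ℝ} {X E : Matrix (Fin k) (Fin k) ℝ}
    (hσ : ∀ i, σ i ^ 2 = 1) (hX : IsLowerTri X) (hXd : ∀ i, 0 < 1 + X i i)
    (h : X * diagonal σ + diagonal σ * Xᵀ + X * diagonal σ * Xᵀ = E)
    (hE : frobNorm E ^ 2 ≤ 1 / 4) : frobNorm X ^ 2 ≤ 1 / 2 := by
  induction k with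
  | zero => simp [frobNorm_sq]
  | succ k ih =>
    have hent : ∀ i j, E i j = X i j * σ j + σ i * X j i + ∑ l, X i l * σ l * X j l := by
      intro i j
      rw [← h, add_mul_diagonal_mul_transpose_apply]
    have hlast : ∀ i : Fin k, X i.castSucc (Fin.last k) = 0 := fun i =>
      hX _ _ (Fin.castSucc_lt_last i)
    let X₁ : Matrix (Fin k) (Fin k) ℝ := X.submatrix Fin.castSucc Fin.castSucc
    let E₁ : Matrix (Fin k) (Fin k) ℝ := E.submatrix Fin.castSucc Fin.castSucc
    let σ₁ : Fin k → ℝ := fun i => σ i.castSucc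
    let e : Fin k → ℝ := fun i => E i.castSucc (Fin.last k)
    let v : Fin k → ℝ := fun i => X (Fin.last k) i.castSucc
    have hσ₁ : ∀ i, σ₁ i ^ 2 = 1 := fun i => hσ _
    have hX₁ : IsLowerTri X₁ := fun i j hij => hX _ _ (Fin.castSucc_lt_castSucc_iff.2 hij)
    have h₁ : X₁ * diagonal σ₁ + diagonal σ₁ * X₁ᵀ + X₁ * diagonal σ₁ * X₁ᵀ = E₁ := by
      ext i j
      have := hent i.castSucc j.castSucc
      rw [Fin.sum_univ_castSucc, hlast] at this
      rw [add_mul_diagonal_mul_transpose_apply]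
      simp [E₁, X₁, σ₁, this]
    have hsymm : ∀ i, E (Fin.last k) i = E i (Fin.last k) := by
      intro i
      rw [hent, hent, Finset.sum_congr rfl fun l _ => mul_right_comm _ (σ l) _,
        Finset.sum_congr rfl fun l _ => mul_right_comm (X i l) (σ l) _]
      simp only [mul_comm (X (Fin.last k) _) (X i _)]
      ring
    have hEsum : frobNorm E ^ 2
        = frobNorm E₁ ^ 2 + 2 * ∑ i, e i ^ 2 + E (Fin.last k) (Fin.last k) ^ 2 := by
      simp only [frobNorm_sq, Fin.sum_univ_castSucc, Finset.sum_add_distrib, hsymm, e, E₁,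
        Matrix.submatrix_apply]
      ring
    have hXsum : frobNorm X ^ 2
        = frobNorm X₁ ^ 2 + ∑ i, v i ^ 2 + X (Fin.last k) (Fin.last k) ^ 2 := by
      simp only [frobNorm_sq, Fin.sum_univ_castSucc, Finset.sum_add_distrib, hlast, v, X₁,
        Matrix.submatrix_apply]
      simp
    have he0 : 0 ≤ ∑ i, e i ^ 2 := Finset.sum_nonneg fun _ _ => sq_nonneg _
    have hv0 : 0 ≤ ∑ i, v i ^ 2 := Finset.sum_nonneg fun _ _ => sq_nonneg _
    have hX₁2 : frobNorm X₁ ^ 2 ≤ 1 / 2 := ih hσ₁ hX₁ (fun i => hXd _) h₁ (by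
      nlinarith [sq_nonneg (E (Fin.last k) (Fin.last k))])
    have hw : ∀ i, e i = σ₁ i * v i + ∑ l, X₁ i l * (σ₁ l * v l) := by
      intro i
      have := hent i.castSucc (Fin.last k)
      rw [Fin.sum_univ_castSucc, hlast] at this
      simp [e, X₁, σ₁, v, this, mul_assoc]
    have hwe := sqrt_sum_sq_mul_one_sub_frobNorm_le X₁ (fun i => σ₁ i * v i) e hw
    simp only [mul_pow, hσ₁, one_mul] at hwe
    have hX₁le : frobNorm X₁ ≤ 1 := by nlinarith [frobNorm_nonneg X₁]
    have hve : (∑ i, v i ^ 2) * (1 - frobNorm X₁) ^ 2 ≤ ∑ i, e i ^ 2 := by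
      have := pow_le_pow_left₀
        (mul_nonneg (Real.sqrt_nonneg _) (sub_nonneg.2 hX₁le)) hwe 2
      rwa [mul_pow, Real.sq_sqrt hv0, Real.sq_sqrt he0] at this
    have hdiag := hent (Fin.last k) (Fin.last k)
    rw [Fin.sum_univ_castSucc] at hdiag
    have hσabs : ∀ i, |σ i| = 1 := fun i => by
      rw [← Real.sqrt_sq_eq_abs, hσ, Real.sqrt_one]
    have hvabs : |∑ l : Fin k, X (Fin.last k) l.castSucc * σ l.castSucc *
        X (Fin.last k) l.castSucc| ≤ ∑ i, v i ^ 2 := by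
      refine (Finset.abs_sum_le_sum_abs _ _).trans (Finset.sum_le_sum fun l _ => ?_)
      rw [abs_mul, abs_mul, hσabs, mul_one, abs_mul_abs_self, ← sq]
    have hξ : |X (Fin.last k) (Fin.last k)| ≤
        |E (Fin.last k) (Fin.last k)| + ∑ i, v i ^ 2 := by
      set ξ := X (Fin.last k) (Fin.last k) with hξdef
      have h1 : |ξ| ≤ |σ (Fin.last k) * (ξ * (2 + ξ))| := by
        rw [abs_mul, hσabs, one_mul, abs_mul]
        have h2 := hXd (Fin.last k)
        exact le_mul_of_one_le_right (abs_nonneg _) (le_trans (by linarith) (le_abs_self _))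
      have h2 : σ (Fin.last k) * (ξ * (2 + ξ)) = E (Fin.last k) (Fin.last k) -
          ∑ l : Fin k, X (Fin.last k) l.castSucc * σ l.castSucc * X (Fin.last k) l.castSucc := by
        rw [hdiag]; ring
      rw [h2] at h1
      linarith [abs_sub (E (Fin.last k) (Fin.last k)) (∑ l : Fin k, X (Fin.last k) l.castSucc *
        σ l.castSucc * X (Fin.last k) l.castSucc)]
    rw [hXsum]
    exact sq_add_add_sq_le_half (frobNorm_nonneg X₁) hX₁2
      (sqrt_two_mul_frobNorm_le_add_sq hσ₁ hX₁ h₁) (hEsum ▸ hE) hv0 hve hξ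

/-- The weighted bound in terms of the congruence-transformed perturbation `E`. -/
lemma frobNorm_transpose_mul_mul_one_sub_le {k : ℕ} {σ : Fin k → ℝ}
    {X E D : Matrix (Fin k) (Fin k) ℝ} (hσ : ∀ i, σ i ^ 2 = 1) (hX : IsLowerTri X)
    (h : X * diagonal σ + diagonal σ * Xᵀ + X * diagonal σ * Xᵀ = E) (hD : D.IsDiag) :
    frobNorm (Xᵀ * D) * (1 - frobNorm X) ≤ frobNorm (E * D) := by
  obtain ⟨d, rfl⟩ : ∃ d, D = diagonal d := ⟨_, hD.diagonal_diag.symm⟩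
  set A := X * diagonal σ + diagonal σ * Xᵀ with hA
  have h1 : frobNorm (Xᵀ * diagonal d) ≤ frobNorm (A * diagonal d) := by
    refine Real.sqrt_le_sqrt (Finset.sum_le_sum fun i _ => Finset.sum_le_sum fun j _ => ?_)
    rw [Matrix.mul_diagonal, Matrix.mul_diagonal, mul_pow, mul_pow]
    exact mul_le_mul_of_nonneg_right (sq_apply_transpose_le_of_isLowerTri hσ hX i j)
      (sq_nonneg _)
  have h2 : A * diagonal d = E * diagonal d - X * (diagonal σ * (Xᵀ * diagonal d)) := by
    rw [← h]
    simp only [Matrix.add_mul, Matrix.mul_assoc]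
    abel
  have h3 := frobNorm_sub_le (E * diagonal d) (X * (diagonal σ * (Xᵀ * diagonal d)))
  have h4 := frobNorm_mul_le X (diagonal σ * (Xᵀ * diagonal d))
  rw [frobNorm_diagonal_mul hσ] at h4
  rw [h2] at h1
  linarith

lemma IsLowerTri.blockTriangular {k : ℕ} {A : Matrix (Fin k) (Fin k) ℝ} (hA : IsLowerTri A) :
    A.BlockTriangular OrderDual.toDual :=
  fun i j hij => hA i j hij

lemma IsLowerTri.isUnit_det {k : ℕ} {A : Matrix (Fin k) (Fin k) ℝ} (hA : IsLowerTri A)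
    (hAd : PosDiag A) : IsUnit A.det := by
  rw [Matrix.det_of_isLowerTriangular A hA.blockTriangular]
  exact (Finset.prod_pos fun i _ => hAd i).ne'.isUnit

lemma IsLowerTri.inv {k : ℕ} {A : Matrix (Fin k) (Fin k) ℝ} (hA : IsLowerTri A)
    (hAd : PosDiag A) : IsLowerTri A⁻¹ := by
  have := A.invertibleOfIsUnitDet (hA.isUnit_det hAd)
  intro i j hij
  exact Matrix.blockTriangular_inv_of_blockTriangular hA.blockTriangular hij

lemma IsLowerTri.mul_apply_self {k : ℕ} {A B : Matrix (Fin k) (Fin k) ℝ} (hA : IsLowerTri A)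
    (hB : IsLowerTri B) (i : Fin k) : (A * B) i i = A i i * B i i := by
  rw [Matrix.mul_apply, Finset.sum_eq_single i]
  · intro j _ hj
    rcases lt_or_gt_of_ne hj with h | h
    · rw [hB j i h, mul_zero]
    · rw [hA i j h, zero_mul]
  · simp

lemma IsLowerTri.posDiag_inv_mul {k : ℕ} {A B : Matrix (Fin k) (Fin k) ℝ} (hA : IsLowerTri A)
    (hAd : PosDiag A) (hB : IsLowerTri B) (hBd : PosDiag B) : PosDiag (A⁻¹ * B) := by
  intro i
  have h := hA.mul_apply_self (hA.inv hAd) i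
  rw [Matrix.mul_nonsing_inv _ (hA.isUnit_det hAd), Matrix.one_apply_eq] at h
  have h1 : 0 < A⁻¹ i i := pos_of_mul_pos_right (h ▸ one_pos) (hAd i).le
  rw [(hA.inv hAd).mul_apply_self hB]
  exact mul_pos h1 (hBd i)

theorem stmt11 (m n : ℕ) (K L dK dL D : Matrix (Fin (m + n)) (Fin (m + n)) ℝ)
    (hK : Kᵀ = K) (hL : IsLowerTri L) (hLd : PosDiag L)
    (hfact : K = L * Jmat m n * Lᵀ)
    (hdK : dKᵀ = dK)
    (hsmall : specNorm L⁻¹ ^ 2 * frobNorm dK < 1 / 2)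
    (hL' : IsLowerTri (L + dL)) (hL'd : PosDiag (L + dL))
    (hfact' : K + dK = (L + dL) * Jmat m n * (L + dL)ᵀ)
    (hD : D.IsDiag) (hDpos : ∀ i, 0 < D i i) :
    frobNorm (dLᵀ * L⁻¹ᵀ * D) ≤
      Real.sqrt 2 * specNorm L⁻¹ * specNorm (L⁻¹ᵀ * D) * frobNorm dK /
        (Real.sqrt 2 - 1 + Real.sqrt (1 - 2 * specNorm L⁻¹ ^ 2 * frobNorm dK)) := by
  obtain ⟨σ, hσJ⟩ : ∃ σ : Fin (m + n) → ℝ,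
      σ = fun i : Fin (m + n) => if (i : ℕ) < m then (1 : ℝ) else -1 := ⟨_, rfl⟩
  have hJ : Jmat m n = diagonal σ := by rw [hσJ]; rfl
  have hσ : ∀ i, σ i ^ 2 = 1 := by
    intro i
    rw [hσJ]
    dsimp only
    split_ifs <;> norm_num
  have hdet := hL.isUnit_det hLd
  have hinv : L⁻¹ * L = 1 := Matrix.nonsing_inv_mul _ hdet
  have hinvT : Lᵀ * L⁻¹ᵀ = 1 := by rw [← Matrix.transpose_mul, hinv, Matrix.transpose_one]
  obtain ⟨X, hXdef⟩ : ∃ X, X = L⁻¹ * dL := ⟨_, rfl⟩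
  obtain ⟨E, hEdef⟩ : ∃ E, E = L⁻¹ * (dK * L⁻¹ᵀ) := ⟨_, rfl⟩
  have hX1 : L⁻¹ * (L + dL) = 1 + X := by rw [Matrix.mul_add, hinv, hXdef]
  have hXT : dLᵀ * L⁻¹ᵀ = Xᵀ := by rw [hXdef, Matrix.transpose_mul]
  have hX : IsLowerTri X := by
    rw [hXdef]
    refine (hL.inv hLd).mul fun i j hij => ?_
    have := hL' i j hij
    rwa [Matrix.add_apply, hL i j hij, zero_add] at this
  have hXd : ∀ i, 0 < 1 + X i i := by
    intro i
    have := hL.posDiag_inv_mul hLd hL' hL'd i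
    rwa [hX1, Matrix.add_apply, Matrix.one_apply_eq] at this
  have heq : X * diagonal σ + diagonal σ * Xᵀ + X * diagonal σ * Xᵀ = E := by
    have h1 : dK = L * diagonal σ * dLᵀ + dL * diagonal σ * Lᵀ + dL * diagonal σ * dLᵀ := by
      rw [← add_right_inj K, hfact', hfact, hJ]
      simp only [Matrix.transpose_add, Matrix.add_mul, Matrix.mul_add]
      abel
    rw [hEdef, h1, ← hXT, hXdef]
    simp only [Matrix.add_mul, Matrix.mul_add, Matrix.mul_assoc, hinvT, Matrix.mul_one]
    rw [← Matrix.mul_assoc L⁻¹ L, hinv, Matrix.one_mul]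
    abel
  obtain ⟨ε, hε⟩ : ∃ ε, ε = specNorm L⁻¹ ^ 2 * frobNorm dK := ⟨_, rfl⟩
  have hEε : frobNorm E ≤ ε := by
    have h1 := frobNorm_mul_le_specNorm_mul L⁻¹ (dK * L⁻¹ᵀ)
    have h2 := mul_le_mul_of_nonneg_left (frobNorm_mul_le_mul_specNorm dK L⁻¹ᵀ)
      (specNorm_nonneg L⁻¹)
    rw [specNorm_transpose] at h2
    rw [hEdef, hε]
    linarith
  have hED : frobNorm (E * D) ≤ specNorm L⁻¹ * specNorm (L⁻¹ᵀ * D) * frobNorm dK := by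
    have h1 := frobNorm_mul_le_specNorm_mul L⁻¹ (dK * (L⁻¹ᵀ * D))
    have h2 := mul_le_mul_of_nonneg_left (frobNorm_mul_le_mul_specNorm dK (L⁻¹ᵀ * D))
      (specNorm_nonneg L⁻¹)
    rw [hEdef, Matrix.mul_assoc, Matrix.mul_assoc]
    linarith
  rw [← hε] at hsmall
  have hhalf : frobNorm X ^ 2 ≤ 1 / 2 := frobNorm_sq_le_half_of_isLowerTri hσ hX hXd heq (by
    nlinarith [frobNorm_nonneg E])
  have hquad := sqrt_two_mul_frobNorm_le_add_sq hσ hX heq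
  have hmain := frobNorm_transpose_mul_mul_one_sub_le hσ hX heq hD
  have hr2 : Real.sqrt 2 ^ 2 = 2 := Real.sq_sqrt zero_le_two
  have hr1 : 1 < Real.sqrt 2 := Real.lt_sqrt_of_sq_lt (by norm_num)
  have hx0 := frobNorm_nonneg X
  have hbranch : Real.sqrt (1 - 2 * ε) ≤ 1 - Real.sqrt 2 * frobNorm X := by
    have hs : Real.sqrt 2 * frobNorm X ≤ 1 :=
      le_of_sq_le_sq (by rw [mul_pow, hr2]; linarith) zero_le_one
    refine Real.sqrt_le_iff.2 ⟨by linarith, ?_⟩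
    nlinarith
  rw [hXT, mul_assoc 2, ← hε, le_div_iff₀ (by linarith [Real.sqrt_nonneg (1 - 2 * ε)])]
  have hcoef : Real.sqrt 2 - 1 + Real.sqrt (1 - 2 * ε) ≤ Real.sqrt 2 * (1 - frobNorm X) := by
    linarith
  calc frobNorm (Xᵀ * D) * (Real.sqrt 2 - 1 + Real.sqrt (1 - 2 * ε))
      ≤ frobNorm (Xᵀ * D) * (Real.sqrt 2 * (1 - frobNorm X)) :=
        mul_le_mul_of_nonneg_left hcoef (frobNorm_nonneg _)
    _ = Real.sqrt 2 * (frobNorm (Xᵀ * D) * (1 - frobNorm X)) := by ring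
    _ ≤ Real.sqrt 2 * (specNorm L⁻¹ * specNorm (L⁻¹ᵀ * D) * frobNorm dK) :=
        mul_le_mul_of_nonneg_left (hmain.trans hED) (Real.sqrt_nonneg 2)
    _ = _ := by ring
end
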